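/- arXiv:1606.04207 — 6 statements merged into one kernel-verified Lean document; each statement's English description precedes it below -/
import Mathlib

section
/- Let l ≥ 0 and k ≥ 2 be integers and let H = ℤ/4ℤ ⋉ (ℤ^l ⊕ ℤ/2^k ℤ). Then the center of H consists of exactly the four elements (0, 0), (2, 0), (0, 2^{k-1}), and (2, 2^{k-1}), where in the second coordinate 0, 2^{k-1} denote the elements (0,…,0, 0) and (0,…,0, 2^{k-1}) of ℤ^l ⊕ ℤ/2^k ℤ. -/
/-- Negation as a multiplicative automorphism of `Multiplicative A`. -/
def negAut (A : Type*) [AddCommGroup A] : MulAut (Multiplicative A) :=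
  AddEquiv.toMultiplicative (AddEquiv.neg A)

/-- The action of `ZMod 2` on `Multiplicative A` where `1` acts by negation. -/
def actZ2 (A : Type*) [AddCommGroup A] :
    Multiplicative (ZMod 2) →* MulAut (Multiplicative A) where
  toFun z := if Multiplicative.toAdd z = 0 then 1 else negAut A
  map_one' := by simp
  map_mul' := fun x y => by
    have h : ∀ z : ZMod 2, z = 0 ∨ z = 1 := by decide
    have h2 : negAut A * negAut A = 1 := by
      ext a
      simp [negAut]
    rcases h (Multiplicative.toAdd x) with hx | hx <;>
      rcases h (Multiplicative.toAdd y) with hy | hy <;>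
      simp [toAdd_mul, hx, hy, h2, show (1+1 : ZMod 2) = 0 from by decide]

/-- The action of `ℤ/4` on `Multiplicative A` given by `x • a = (-1)^x • a`;
it factors through `ZMod 4 → ZMod 2`. -/
def negAct (A : Type*) [AddCommGroup A] :
    Multiplicative (ZMod 4) →* MulAut (Multiplicative A) :=
  (actZ2 A).comp (AddMonoidHom.toMultiplicative
    ((ZMod.castHom (by norm_num : (2:ℕ) ∣ 4) (ZMod 2)).toAddMonoidHom))

/-- The semidirect product `ℤ/4 ⋉ A`, with `x : ℤ/4` acting by `a ↦ (-1)^x a`. -/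
abbrev Zfour_sd (A : Type*) [AddCommGroup A] :=
  Multiplicative A ⋊[negAct A] Multiplicative (ZMod 4)

theorem negAct_even {A : Type*} [AddCommGroup A] (x : ZMod 4) (hx : x = 0 ∨ x = 2) :
    negAct A (Multiplicative.ofAdd x) = 1 := by
  rcases hx with h | h <;> subst h <;>
  · ext a
    simp [negAct, actZ2, show (ZMod.cast (0 : ZMod 4) : ZMod 2) = 0 from by decide,
      show (ZMod.cast (2 : ZMod 4) : ZMod 2) = 0 from by decide]

theorem negAct_apply_or {A : Type*} [AddCommGroup A] (x : Multiplicative (ZMod 4))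
    (a : Multiplicative A) : negAct A x a = a ∨ negAct A x a = a⁻¹ := by
  by_cases h : (ZMod.cast (Multiplicative.toAdd x) : ZMod 2) = 0
  · left; simp [negAct, actZ2, h]
  · right
    simp only [negAct, actZ2, MonoidHom.comp_apply, MonoidHom.coe_mk, OneHom.coe_mk]
    rw [if_neg]
    · rfl
    · simpa using h

theorem central_mem {A : Type*} [AddCommGroup A] (a0 : A) (ha : a0 + a0 = 0) (x : ZMod 4)
    (hx : x = 0 ∨ x = 2) :
    (⟨Multiplicative.ofAdd a0, Multiplicative.ofAdd x⟩ : Zfour_sd A) ∈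
      Subgroup.center (Zfour_sd A) := by
  rw [Subgroup.mem_center_iff]
  rintro ⟨b, y⟩
  have hinv : (Multiplicative.ofAdd a0)⁻¹ = Multiplicative.ofAdd a0 := by
    rw [← ofAdd_neg, neg_eq_of_add_eq_zero_left ha]
  ext
  · show b * negAct A y (Multiplicative.ofAdd a0)
        = Multiplicative.ofAdd a0 * negAct A (Multiplicative.ofAdd x) b
    rw [negAct_even x hx]
    rcases negAct_apply_or y (Multiplicative.ofAdd a0) with h | h <;>
      rw [h] <;> simp [hinv, mul_comm]
  · show y * Multiplicative.ofAdd x = Multiplicative.ofAdd x * y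
    exact mul_comm _ _

theorem zpowers_normal_of_central {G : Type*} [Group G] {g : G}
    (hg : g ∈ Subgroup.center G) : (Subgroup.zpowers g).Normal := by
  constructor
  intro x hx h
  rcases Subgroup.mem_zpowers_iff.mp hx with ⟨k, rfl⟩
  have hc := Subgroup.mem_center_iff.mp ((Subgroup.center G).zpow_mem hg k) h
  rw [hc, mul_assoc, mul_inv_cancel, mul_one]
  exact Subgroup.mem_zpowers_iff.mpr ⟨k, rfl⟩

theorem doubling (k : ℕ) : (2^(k-1) : ZMod (2^k)) + 2^(k-1) = 0 := by
  rcases Nat.eq_zero_or_pos k with hk | hk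
  · subst hk; decide
  · rw [← two_mul, ← pow_succ', Nat.sub_add_cancel hk]
    have h := ZMod.natCast_self (2^k)
    push_cast at h
    exact h

/-- The abelian group `ℤ^l ⊕ ℤ/2^k`. -/
abbrev Agrp (l k : ℕ) : Type := (Fin l → ℤ) × ZMod (2^k)

/-- The semidirect product `H = ℤ/4 ⋉ (ℤ^l ⊕ ℤ/2^k)`. -/
abbrev Hgrp (l k : ℕ) := Zfour_sd (Agrp l k)

theorem doublingA (l k : ℕ) :
    (((0 : Fin l → ℤ), (2^(k-1) : ZMod (2^k))) : Agrp l k)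
      + ((0 : Fin l → ℤ), (2^(k-1) : ZMod (2^k))) = 0 := by
  rw [Prod.mk_add_mk, add_zero, doubling k]
  rfl

/-- The element `(2, 2^{k-1})` of `H = ℤ/4 ⋉ (ℤ^l ⊕ ℤ/2^k)`. -/
def relHK (l k : ℕ) : Hgrp l k :=
  ⟨Multiplicative.ofAdd (((0 : Fin l → ℤ), (2^(k-1) : ZMod (2^k))) : Agrp l k),
   Multiplicative.ofAdd (2 : ZMod 4)⟩

theorem relHK_central (l k : ℕ) : relHK l k ∈ Subgroup.center (Hgrp l k) :=
  central_mem _ (doublingA l k) _ (Or.inr rfl)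

instance relHK_zpowers_normal (l k : ℕ) : (Subgroup.zpowers (relHK l k)).Normal :=
  zpowers_normal_of_central (relHK_central l k)

theorem negAct_odd {A : Type*} [AddCommGroup A] (x : ZMod 4) (hx : x = 1 ∨ x = 3)
    (a : Multiplicative A) : negAct A (Multiplicative.ofAdd x) a = a⁻¹ := by
  have h : (ZMod.cast x : ZMod 2) ≠ 0 := by rcases hx with rfl | rfl <;> decide
  simp only [negAct, actZ2, MonoidHom.comp_apply, MonoidHom.coe_mk, OneHom.coe_mk]
  rw [if_neg (by simpa using h)]
  rfl

/-- If `A` is not `2`-torsion, then the center of `ℤ/4 ⋉ A` consists of the pairs `(x, a)` with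
`x` even and `2a = 0`. -/
theorem mem_center_Zfour_sd_iff {A : Type*} [AddCommGroup A] {b : A} (hb : b + b ≠ 0)
    (a : A) (x : ZMod 4) :
    (⟨Multiplicative.ofAdd a, Multiplicative.ofAdd x⟩ : Zfour_sd A) ∈
      Subgroup.center (Zfour_sd A) ↔ a + a = 0 ∧ (x = 0 ∨ x = 2) := by
  refine ⟨fun h => ⟨?_, ?_⟩, fun h => central_mem a h.1 x h.2⟩
  · have hc : 1 * negAct A (Multiplicative.ofAdd 1) (Multiplicative.ofAdd a)
        = Multiplicative.ofAdd a * negAct A (Multiplicative.ofAdd x) 1 :=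
      congrArg SemidirectProduct.left
        (Subgroup.mem_center_iff.mp h ⟨1, Multiplicative.ofAdd 1⟩)
    rw [negAct_odd 1 (Or.inl rfl), map_one, one_mul, mul_one] at hc
    exact neg_eq_iff_add_eq_zero.mp (congrArg Multiplicative.toAdd hc)
  · by_contra hx
    have hodd : x = 1 ∨ x = 3 := by clear h; decide +revert
    have hc : Multiplicative.ofAdd b * negAct A 1 (Multiplicative.ofAdd a)
        = Multiplicative.ofAdd a * negAct A (Multiplicative.ofAdd x) (Multiplicative.ofAdd b) :=
      congrArg SemidirectProduct.left
        (Subgroup.mem_center_iff.mp h ⟨Multiplicative.ofAdd b, 1⟩)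
    rw [negAct_odd x hodd, map_one, MulAut.one_apply, mul_comm] at hc
    exact hb (neg_eq_iff_add_eq_zero.mp
      (congrArg Multiplicative.toAdd (mul_left_cancel hc)).symm)

theorem ZMod.add_self_eq_zero_iff_of_two_pow {k : ℕ} (hk : 1 ≤ k) (x : ZMod (2 ^ k)) :
    x + x = 0 ↔ x = 0 ∨ x = 2 ^ (k - 1) := by
  refine ⟨fun h => ?_, ?_⟩
  · have hpow : 2 ^ k = 2 * 2 ^ (k - 1) := by rw [← pow_succ', Nat.sub_add_cancel hk]
    have hdvd : 2 ^ k ∣ x.val + x.val := by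
      rw [← ZMod.natCast_eq_zero_iff]
      simpa using h
    have hlt := x.val_lt
    obtain ⟨c, hc⟩ := hdvd
    have hc2 : c < 2 := by
      by_contra! hc2
      have := Nat.mul_le_mul_left (2 ^ k) hc2
      omega
    interval_cases c
    · exact Or.inl ((ZMod.val_eq_zero x).mp (by omega))
    · right
      have hval : x.val = 2 ^ (k - 1) := by omega
      rw [← ZMod.natCast_zmod_val x, hval]
      push_cast
      rfl
  · rintro (rfl | rfl)
    · exact add_zero 0
    · exact doubling k

theorem Agrp_add_self_eq_zero_iff {l k : ℕ} (hk : 1 ≤ k) (a : Agrp l k) :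
    a + a = 0 ↔ a = (0, 0) ∨ a = (0, 2 ^ (k - 1)) := by
  obtain ⟨v, z⟩ := a
  have hv : v + v = 0 ↔ v = 0 := by
    rw [← eq_neg_iff_add_eq_zero, self_eq_neg]
  simp only [Prod.mk_add_mk, Prod.mk_eq_zero, Prod.mk.injEq, hv,
    ZMod.add_self_eq_zero_iff_of_two_pow hk, ← and_or_left]

theorem Agrp_exists_add_self_ne_zero {l k : ℕ} (hk : 2 ≤ k) : ∃ b : Agrp l k, b + b ≠ 0 := by
  refine ⟨(0, 1), fun h => ?_⟩
  have h2 : ((2 : ℕ) : ZMod (2 ^ k)) = 0 := by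
    have := congrArg Prod.snd h
    simpa [one_add_one_eq_two] using this
  have hle := Nat.le_of_dvd two_pos ((ZMod.natCast_eq_zero_iff _ _).mp h2)
  have := Nat.pow_le_pow_right two_pos hk
  omega

/-- For `l ≥ 0`, `k ≥ 2`, the center of `H = ℤ/4 ⋉ (ℤ^l ⊕ ℤ/2^k)`
consists exactly of the four elements `(0,0)`, `(2,0)`, `(0,2^{k-1})`, `(2,2^{k-1})`. -/
theorem center_Hgrp_eq (l k : ℕ) (hk : 2 ≤ k) :
    (Subgroup.center (Hgrp l k) : Set (Hgrp l k)) =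
      {(⟨Multiplicative.ofAdd (((0 : Fin l → ℤ), (0 : ZMod (2^k))) : Agrp l k),
          Multiplicative.ofAdd (0 : ZMod 4)⟩ : Hgrp l k),
       ⟨Multiplicative.ofAdd (((0 : Fin l → ℤ), (0 : ZMod (2^k))) : Agrp l k),
          Multiplicative.ofAdd (2 : ZMod 4)⟩,
       ⟨Multiplicative.ofAdd (((0 : Fin l → ℤ), (2^(k-1) : ZMod (2^k))) : Agrp l k),
          Multiplicative.ofAdd (0 : ZMod 4)⟩,
       ⟨Multiplicative.ofAdd (((0 : Fin l → ℤ), (2^(k-1) : ZMod (2^k))) : Agrp l k),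
          Multiplicative.ofAdd (2 : ZMod 4)⟩} := by
  obtain ⟨b, hb⟩ := Agrp_exists_add_self_ne_zero (l := l) hk
  ext ⟨a, x⟩
  obtain ⟨a, rfl⟩ := Multiplicative.ofAdd.surjective a
  obtain ⟨x, rfl⟩ := Multiplicative.ofAdd.surjective x
  rw [SetLike.mem_coe, mem_center_Zfour_sd_iff hb, Agrp_add_self_eq_zero_iff (by omega)]
  simp only [Set.mem_insert_iff, Set.mem_singleton_iff, SemidirectProduct.ext_iff,
    EmbeddingLike.apply_eq_iff_eq]
  tauto
end

section
/- Let l ≥ 0 and k ≥ 2 be integers, let H = ℤ/4ℤ ⋉ (ℤ^l ⊕ ℤ/2^k ℤ), and let K = ⟨(2, 2^{k-1})⟩ be the subgroup generated by the central element (2, 2^{k-1}). Then the quotient group G = H/K has a unique element of order 2; that is, for all x, y ∈ G with x² = y² = 1, either x = 1, or y = 1, or x = y, and G does contain an element of order 2. -/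
theorem two_pow_pred_ne_zero {k : ℕ} (hk : 1 ≤ k) : (2 ^ (k - 1) : ZMod (2 ^ k)) ≠ 0 := by
  intro h
  have h' : ((2 ^ (k - 1) : ℕ) : ZMod (2 ^ k)) = 0 := by exact_mod_cast h
  rw [ZMod.natCast_eq_zero_iff, Nat.pow_dvd_pow_iff_le_right (by norm_num)] at h'
  omega

theorem eq_zero_or_eq_two_pow_pred {k : ℕ} (hk : 1 ≤ k) {b : ZMod (2 ^ k)} (hb : b + b = 0) :
    b = 0 ∨ b = 2 ^ (k - 1) := by
  have hpow : 2 ^ k = 2 * 2 ^ (k - 1) := by rw [← pow_succ', Nat.sub_add_cancel hk]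
  have hlt : b.val < 2 ^ k := b.val_lt
  have hval : ((b.val + b.val : ℕ) : ZMod (2 ^ k)) = 0 := by
    rw [Nat.cast_add, ZMod.natCast_zmod_val, hb]
  rw [ZMod.natCast_eq_zero_iff] at hval
  obtain ⟨c, hc⟩ := hval
  have hc2 : c < 2 := by
    by_contra! h
    nlinarith
  interval_cases c
  · left
    rw [← ZMod.val_eq_zero]
    omega
  · right
    have : b.val = 2 ^ (k - 1) := by omega
    rw [← ZMod.natCast_zmod_val b, this]
    push_cast
    rfl

theorem relHK_left (l k : ℕ) : (relHK l k).left =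
    Multiplicative.ofAdd (((0 : Fin l → ℤ), (2 ^ (k - 1) : ZMod (2 ^ k))) : Agrp l k) :=
  rfl

theorem relHK_right (l k : ℕ) : (relHK l k).right = Multiplicative.ofAdd (2 : ZMod 4) :=
  rfl

theorem relHK_sq (l k : ℕ) : relHK l k * relHK l k = 1 := by
  ext1
  · rw [SemidirectProduct.mul_left, SemidirectProduct.one_left, relHK_right, relHK_left,
      negAct_even 2 (Or.inr rfl), MulAut.one_apply, ← ofAdd_add, doublingA, ofAdd_zero]
  · rw [SemidirectProduct.mul_right, SemidirectProduct.one_right, relHK_right]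
    decide

theorem mem_zpowers_relHK_iff {l k : ℕ} {h : Hgrp l k} :
    h ∈ Subgroup.zpowers (relHK l k) ↔ h = 1 ∨ h = relHK l k := by
  constructor
  · rintro ⟨n, rfl⟩
    have hsq : relHK l k ^ (2 : ℤ) = 1 := by rw [zpow_two, relHK_sq]
    rcases Int.even_or_odd' n with ⟨m, rfl | rfl⟩
    · left
      simp [zpow_mul, hsq]
    · right
      simp [zpow_add, zpow_mul, hsq]
  · rintro (rfl | rfl)
    · exact one_mem _
    · exact Subgroup.mem_zpowers _

/-- The central element `(0, 2)` of `H`, whose class is the involution of the quotient. -/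
def centralInvolution (l k : ℕ) : Hgrp l k :=
  ⟨1, Multiplicative.ofAdd (2 : ZMod 4)⟩

theorem centralInvolution_left (l k : ℕ) : (centralInvolution l k).left = 1 :=
  rfl

theorem centralInvolution_right (l k : ℕ) :
    (centralInvolution l k).right = Multiplicative.ofAdd (2 : ZMod 4) :=
  rfl

theorem centralInvolution_sq (l k : ℕ) : centralInvolution l k * centralInvolution l k = 1 := by
  ext1
  · rw [SemidirectProduct.mul_left, SemidirectProduct.one_left, centralInvolution_left, map_one,
      one_mul]
  · rw [SemidirectProduct.mul_right, SemidirectProduct.one_right, centralInvolution_right]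
    decide

theorem centralInvolution_notMem {l k : ℕ} (hk : 1 ≤ k) :
    centralInvolution l k ∉ Subgroup.zpowers (relHK l k) := by
  rw [mem_zpowers_relHK_iff]
  rintro (h | h)
  · exact absurd (congrArg (fun g => Multiplicative.toAdd g.right) h)
      (by change ¬ ((2 : ZMod 4) = 0); decide)
  · exact two_pow_pred_ne_zero hk
      (congrArg (fun g => (Multiplicative.toAdd g.left).2) h).symm

theorem eq_zero_or_of_add_self {l k : ℕ} (hk : 1 ≤ k) {a : Agrp l k} (ha : a + a = 0) :
    a = 0 ∨ a = ((0 : Fin l → ℤ), (2 ^ (k - 1) : ZMod (2 ^ k))) := by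
  obtain ⟨v, b⟩ := a
  have hv : v = 0 := by
    funext i
    have := congrFun (congrArg Prod.fst ha) i
    simp only [Prod.fst_add, Pi.add_apply, Prod.fst_zero, Pi.zero_apply] at this
    simp only [Pi.zero_apply]
    omega
  subst hv
  rcases eq_zero_or_eq_two_pow_pred hk (congrArg Prod.snd ha) with rfl | rfl
  · exact Or.inl rfl
  · exact Or.inr rfl

theorem mem_zpowers_or_mul_centralInvolution_mem {l k : ℕ} (hk : 1 ≤ k) {h : Hgrp l k}
    (hh : h * h ∈ Subgroup.zpowers (relHK l k)) :
    h ∈ Subgroup.zpowers (relHK l k) ∨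
      h * centralInvolution l k ∈ Subgroup.zpowers (relHK l k) := by
  obtain ⟨a, x⟩ := h
  have hcases : ∀ z : ZMod 4, (z = 0 ∨ z = 2) ∨ (z = 1 ∨ z = 3) := by decide
  rw [mem_zpowers_relHK_iff] at hh
  rcases hcases (Multiplicative.toAdd x) with hx | hx
  · have hact : negAct (Agrp l k) x = 1 := negAct_even _ hx
    have ha : a * a = 1 := by
      rcases hh with hh | hh
      · have := congrArg SemidirectProduct.left hh
        simpa [hact] using this
      · have hr : Multiplicative.toAdd x + Multiplicative.toAdd x = 2 :=
          congrArg (fun g => Multiplicative.toAdd g.right) hh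
        rcases hx with hx | hx <;> rw [hx] at hr <;> exact absurd hr (by decide)
    have hmul : (⟨a, x⟩ : Hgrp l k) * centralInvolution l k =
        ⟨a, x * Multiplicative.ofAdd (2 : ZMod 4)⟩ := by
      ext1
      · change a * negAct _ x 1 = a
        rw [map_one, mul_one]
      · rfl
    rw [hmul, mem_zpowers_relHK_iff, mem_zpowers_relHK_iff]
    have ha' : a = Multiplicative.ofAdd (0 : Agrp l k) ∨ a = Multiplicative.ofAdd
        (((0 : Fin l → ℤ), (2 ^ (k - 1) : ZMod (2 ^ k))) : Agrp l k) :=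
      eq_zero_or_of_add_self hk (a := Multiplicative.toAdd a) ha
    have hx' : x = Multiplicative.ofAdd 0 ∨ x = Multiplicative.ofAdd 2 := hx
    rcases ha' with rfl | rfl <;> rcases hx' with rfl | rfl
    · exact Or.inl (Or.inl rfl)
    · exact Or.inr (Or.inl rfl)
    · exact Or.inr (Or.inr rfl)
    · exact Or.inl (Or.inr rfl)
  · exfalso
    have hact : negAct (Agrp l k) x a = a⁻¹ := negAct_odd _ hx a
    rcases hh with hh | hh
    · have hr : Multiplicative.toAdd x + Multiplicative.toAdd x = 0 :=
        congrArg (fun g => Multiplicative.toAdd g.right) hh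
      rcases hx with hx | hx <;> rw [hx] at hr <;> exact absurd hr (by decide)
    · have hl : a * negAct (Agrp l k) x a = (relHK l k).left :=
        congrArg SemidirectProduct.left hh
      rw [hact, mul_inv_cancel] at hl
      exact two_pow_pred_ne_zero hk
        (congrArg (fun g => (Multiplicative.toAdd g).2) hl).symm

theorem eq_one_or_eq_centralInvolution {l k : ℕ} (hk : 1 ≤ k)
    {x : Hgrp l k ⧸ Subgroup.zpowers (relHK l k)} (hx : x ^ 2 = 1) :
    x = 1 ∨ x = (centralInvolution l k : Hgrp l k ⧸ Subgroup.zpowers (relHK l k)) := by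
  induction x using QuotientGroup.induction_on with
  | H h =>
    rw [← QuotientGroup.mk_pow, QuotientGroup.eq_one_iff, pow_two] at hx
    refine (mem_zpowers_or_mul_centralInvolution_mem hk hx).imp
      (QuotientGroup.eq_one_iff _).mpr fun hm => ?_
    rw [← QuotientGroup.eq_one_iff, QuotientGroup.mk_mul] at hm
    rw [eq_inv_of_mul_eq_one_left hm, ← QuotientGroup.mk_inv,
      inv_eq_of_mul_eq_one_left (centralInvolution_sq l k)]

/-- For `l ≥ 0`, `k ≥ 2`, the quotient
`G = (ℤ/4 ⋉ (ℤ^l ⊕ ℤ/2^k)) / ⟨(2, 2^{k-1})⟩` has a unique element of order `2`: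
if `x² = y² = 1` then `x = 1`, `y = 1` or `x = y`, and `G` contains an element of order `2`. -/
theorem quotient_unique_involution (l k : ℕ) (hk : 2 ≤ k) :
    (∀ x y : Hgrp l k ⧸ Subgroup.zpowers (relHK l k),
        x^2 = 1 → y^2 = 1 → x = 1 ∨ y = 1 ∨ x = y) ∧
    ∃ x : Hgrp l k ⧸ Subgroup.zpowers (relHK l k), orderOf x = 2 := by
  have hk1 : 1 ≤ k := by omega
  refine ⟨fun x y hx hy => ?_, (centralInvolution l k : Hgrp l k ⧸ _), ?_⟩
  · rcases eq_one_or_eq_centralInvolution hk1 hx with h | h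
    · exact Or.inl h
    · rcases eq_one_or_eq_centralInvolution hk1 hy with h' | h'
      · exact Or.inr (Or.inl h')
      · exact Or.inr (Or.inr (h.trans h'.symm))
  · refine orderOf_eq_prime ?_ ?_
    · rw [← QuotientGroup.mk_pow, pow_two, centralInvolution_sq, QuotientGroup.mk_one]
    · rw [Ne, QuotientGroup.eq_one_iff]
      exact centralInvolution_notMem hk1
end

section
/- Let l ≥ 0 and k ≥ 2 be integers. The abelian group A = ℤ^l ⊕ ℤ/2^k ℤ is fully residually a cyclic 2-group: for every finite subset E ⊆ A there exist an integer n ≥ k and a group homomorphism α : A → ℤ/2^n ℤ whose restriction to E is injective. -/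
theorem exists_linearMap_int_forall_ne_zero {l : ℕ} (D : Set (Fin l → ℤ)) (hD : D.Finite)
    (h0 : 0 ∉ D) : ∃ φ : (Fin l → ℤ) →ₗ[ℤ] ℤ, ∀ v ∈ D, φ v ≠ 0 := by
  let P : (Fin l → ℤ) →ₗ[ℤ] Polynomial ℤ :=
    ∑ i : Fin l, (Polynomial.monomial (i : ℕ)).comp (LinearMap.proj i)
  have hP : ∀ v, P v = 0 → v = 0 := by
    intro v hv
    ext j
    simpa [P, Polynomial.finsetSum_coeff, Polynomial.coeff_monomial, Fin.val_inj] using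
      congrArg (fun p => Polynomial.coeff p (j : ℕ)) hv
  have hprod : ∏ v ∈ hD.toFinset, P v ≠ 0 := by
    rw [Finset.prod_ne_zero_iff]
    intro v hv h
    exact h0 (hP v h ▸ hD.mem_toFinset.mp hv)
  obtain ⟨a, ha⟩ : ∃ a : ℤ, (∏ v ∈ hD.toFinset, P v).eval a ≠ 0 := by
    by_contra! h
    exact hprod (Polynomial.funext fun a => by simpa using h a)
  rw [Polynomial.eval_prod, Finset.prod_ne_zero_iff] at ha
  exact ⟨(Polynomial.leval a).comp P, fun v hv => ha v (hD.mem_toFinset.mpr hv)⟩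

/-- The embedding of `ℤ/2^k` into `ℤ/2^(k+m)` given by multiplication by `2^m`. -/
def zmodTwoPowMul (k m : ℕ) : ZMod (2 ^ k) →+ ZMod (2 ^ (k + m)) :=
  ZMod.lift (2 ^ k) ⟨zmultiplesHom _ (2 ^ m), by
    have h := ZMod.natCast_self (2 ^ (k + m))
    simpa [pow_add] using h⟩

theorem zmodTwoPowMul_intCast (k m : ℕ) (c : ℤ) :
    zmodTwoPowMul k m c = ((2 ^ m * c : ℤ) : ZMod (2 ^ (k + m))) := by
  simp [zmodTwoPowMul, mul_comm]

/-- For `l ≥ 0`, `k ≥ 2`, the abelian group `A = ℤ^l ⊕ ℤ/2^k` is fully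
residually a cyclic `2`-group: every finite subset is mapped injectively by some
homomorphism `A →+ ℤ/2^n` with `n ≥ k`. -/
theorem Agrp_fully_residually_cyclic_two_group (l k : ℕ) (hk : 2 ≤ k)
    (E : Set (Agrp l k)) (hE : E.Finite) :
    ∃ n : ℕ, k ≤ n ∧ ∃ α : Agrp l k →+ ZMod (2^n), Set.InjOn α E := by
  have hD : (Set.image2 (· - ·) E E).Finite := hE.image2 _ hE
  obtain ⟨φ, hφ⟩ := exists_linearMap_int_forall_ne_zero
    (Prod.fst '' Set.image2 (· - ·) E E \ {0}) ((hD.image _).subset Set.sdiff_subset) (by simp)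
  obtain ⟨m, hm⟩ := (hD.image fun x => (φ x.1).natAbs).bddAbove
  refine ⟨k + m, Nat.le_add_right k m,
    ((Int.castAddHom (ZMod (2 ^ (k + m)))).comp φ.toAddMonoidHom).coprod (zmodTwoPowMul k m), ?_⟩
  intro x hx y hy hxy
  rw [← sub_eq_zero, ← map_sub] at hxy
  have hmem : x - y ∈ Set.image2 (· - ·) E E := Set.mem_image2_of_mem hx hy
  rw [← sub_eq_zero]
  generalize x - y = z at hxy hmem
  obtain ⟨v, c⟩ := z
  obtain ⟨c, rfl⟩ := ZMod.intCast_surjective c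
  have hdvd : (2 ^ (k + m) : ℤ) ∣ φ v + 2 ^ m * c := by
    have h : ((φ v + 2 ^ m * c : ℤ) : ZMod (2 ^ (k + m))) = 0 := by
      rw [Int.cast_add, ← zmodTwoPowMul_intCast]
      simpa using hxy
    exact_mod_cast (ZMod.intCast_zmod_eq_zero_iff_dvd _ _).mp h
  have hv : v = 0 := by
    by_contra hv
    refine hφ v ⟨⟨_, hmem, rfl⟩, hv⟩ (Int.eq_zero_of_abs_lt_dvd (m := 2 ^ m) ?_ ?_)
    · exact (Int.dvd_add_left (Dvd.intro _ rfl)).mp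
        ((pow_dvd_pow 2 (Nat.le_add_left m k)).trans hdvd)
    · have h : (φ v).natAbs < 2 ^ m := (hm ⟨_, hmem, rfl⟩).trans_lt Nat.lt_two_pow_self
      rw [Int.abs_eq_natAbs]
      exact_mod_cast h
  subst hv
  rw [map_zero, zero_add, pow_add, mul_comm, mul_dvd_mul_iff_left (by positivity)] at hdvd
  have hc : (c : ZMod (2 ^ k)) = 0 := by
    rw [ZMod.intCast_zmod_eq_zero_iff_dvd]
    exact_mod_cast hdvd
  rw [hc]
  rfl
end

section
/- Let l ≥ 0 and k ≥ 2 be integers and let H = ℤ/4ℤ ⋉ (ℤ^l ⊕ ℤ/2^k ℤ). Then for every finite subset E ⊆ H there exist an integer n ≥ 3 and a group homomorphism α : H → ℤ/4ℤ ⋉ ℤ/2^{n-1}ℤ whose restriction to E is injective; that is, H is fully residually the class of groups {ℤ/4ℤ ⋉ ℤ/2^{n-1}ℤ : n ≥ 3}. -/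
theorem doublingQ (n : ℕ) :
    (2^(n-2) : ZMod (2^(n-1))) + 2^(n-2) = 0 := by
  have h := doubling (n-1)
  rwa [show n - 1 - 1 = n - 2 by omega] at h

/-- The element `(2, 2^{n-2})` of `ℤ/4 ⋉ ℤ/2^{n-1}`. -/
def quatRel (n : ℕ) : Zfour_sd (ZMod (2^(n-1))) :=
  ⟨Multiplicative.ofAdd (2^(n-2) : ZMod (2^(n-1))), Multiplicative.ofAdd (2 : ZMod 4)⟩

theorem quatRel_central (n : ℕ) :
    quatRel n ∈ Subgroup.center (Zfour_sd (ZMod (2^(n-1)))) :=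
  central_mem _ (doublingQ n) _ (Or.inr rfl)

instance quatRel_zpowers_normal (n : ℕ) : (Subgroup.zpowers (quatRel n)).Normal :=
  zpowers_normal_of_central (quatRel_central n)

theorem map_negAct {A B : Type*} [AddCommGroup A] [AddCommGroup B] (f : A →+ B)
    (x : Multiplicative (ZMod 4)) (a : Multiplicative A) :
    f.toMultiplicative (negAct A x a) = negAct B x (f.toMultiplicative a) := by
  by_cases h : (ZMod.cast (Multiplicative.toAdd x) : ZMod 2) = 0
  · simp [negAct, actZ2, h]
  · simp only [negAct, actZ2, MonoidHom.comp_apply, MonoidHom.coe_mk, OneHom.coe_mk]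
    rw [if_neg (by simpa using h), if_neg (by simpa using h)]
    exact map_inv f.toMultiplicative a

/-- The homomorphism `ℤ/4 ⋉ A →* ℤ/4 ⋉ B` induced by an additive homomorphism `A →+ B`. -/
def Zfour_sd.map {A B : Type*} [AddCommGroup A] [AddCommGroup B] (f : A →+ B) :
    Zfour_sd A →* Zfour_sd B :=
  SemidirectProduct.map f.toMultiplicative (MonoidHom.id _) fun x =>
    MonoidHom.ext fun a => map_negAct f x a

theorem Zfour_sd.map_injOn {A B : Type*} [AddCommGroup A] [AddCommGroup B] (f : A →+ B)
    (E : Set (Zfour_sd A))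
    (h : ∀ x ∈ E, ∀ y ∈ E, f (x.left.toAdd - y.left.toAdd) = 0 →
      x.left.toAdd - y.left.toAdd = 0) :
    Set.InjOn (Zfour_sd.map f) E := by
  intro x hx y hy hxy
  have hl : f x.left.toAdd = f y.left.toAdd := congrArg (fun z => z.left.toAdd) hxy
  have hr : x.right = y.right := congrArg (fun z => z.right) hxy
  refine SemidirectProduct.ext (Multiplicative.toAdd.injective ?_) hr
  exact sub_eq_zero.mp (h x hx y hy (by rw [map_sub, hl, sub_self]))

theorem exists_addMonoidHom_int_ne_zero {l : ℕ} {D : Set (Fin l → ℤ)} (hD : D.Finite) :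
    ∃ φ : (Fin l → ℤ) →+ ℤ, ∀ v ∈ D, φ v = 0 → v = 0 := by
  classical
  let P : (Fin l → ℤ) → Polynomial ℤ := fun v => (Polynomial.degreeLTEquiv ℤ l).symm v
  have hP (v) (hv : P v = 0) : v = 0 :=
    (Polynomial.degreeLTEquiv ℤ l).symm.map_eq_zero_iff.mp (Subtype.ext hv)
  have hfin : (⋃ v ∈ D, ((P v).roots.toFinset : Set ℤ)).Finite :=
    hD.biUnion fun v _ => Finset.finite_toSet _
  obtain ⟨t, ht⟩ := hfin.exists_notMem
  refine ⟨((Polynomial.leval t).comp ((Polynomial.degreeLT ℤ l).subtype.comp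
    (Polynomial.degreeLTEquiv ℤ l).symm.toLinearMap)).toAddMonoidHom, fun v hv h0 => ?_⟩
  by_contra hne
  refine ht (Set.mem_biUnion hv ?_)
  have hr : (P v).IsRoot t := h0
  simpa using ⟨fun h => hne (hP v h), hr⟩

theorem exists_addMonoidHom_zmod_two_pow {l : ℕ} (k : ℕ) {D : Set (Agrp l k)} (hD : D.Finite) :
    ∃ s : ℕ, 1 ≤ s ∧ ∃ f : Agrp l k →+ ZMod (2 ^ (k + s)), ∀ a ∈ D, f a = 0 → a = 0 := by
  obtain ⟨φ, hφ⟩ := exists_addMonoidHom_int_ne_zero (hD.image Prod.fst)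
  obtain ⟨N, hN⟩ := (hD.image fun a => (φ a.1).natAbs).bddAbove
  have hlift : zmultiplesHom (ZMod (2 ^ (k + N + 1))) (2 ^ (N + 1)) ((2 ^ k : ℕ) : ℤ) = 0 := by
    have h := ZMod.natCast_self (2 ^ (k + N + 1))
    push_cast at h
    simp [← pow_add, ← add_assoc, h]
  refine ⟨N + 1, by omega, (((Int.castAddHom _).comp φ).comp (AddMonoidHom.fst _ _)) +
    (ZMod.lift (2 ^ k) ⟨_, hlift⟩).comp (AddMonoidHom.snd _ _), ?_⟩
  rintro ⟨v, c⟩ ha h0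
  obtain ⟨z, rfl⟩ := ZMod.intCast_surjective c
  have hz : ((φ v + z * 2 ^ (N + 1) : ℤ) : ZMod (2 ^ (k + N + 1))) = 0 := by
    simpa [ZMod.lift_coe] using h0
  rw [ZMod.intCast_zmod_eq_zero_iff_dvd] at hz
  push_cast at hz
  rw [add_assoc, pow_add] at hz
  have hdvd : (2 ^ (N + 1) : ℤ) ∣ φ v :=
    (dvd_add_left (dvd_mul_left _ z)).mp ((dvd_mul_left _ _).trans hz)
  have hφv : φ v = 0 := by
    refine Int.eq_zero_of_abs_lt_dvd hdvd ?_
    have h1 : (φ v).natAbs ≤ N := hN ⟨_, ha, rfl⟩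
    have h2 : N < 2 ^ (N + 1) := (Nat.lt_succ_self N).trans Nat.lt_two_pow_self
    rw [Int.abs_eq_natAbs]
    exact_mod_cast h1.trans_lt h2
  rw [hφv, zero_add] at hz
  have hk := Int.dvd_of_mul_dvd_mul_right (by positivity) hz
  refine Prod.ext (hφ v ⟨_, ha, rfl⟩ hφv) ?_
  exact (ZMod.intCast_zmod_eq_zero_iff_dvd z _).mpr (by exact_mod_cast hk)

/-- For `l ≥ 0`, `k ≥ 2`, the group `H = ℤ/4 ⋉ (ℤ^l ⊕ ℤ/2^k)` is fully
residually the class `{ℤ/4 ⋉ ℤ/2^{n-1} : n ≥ 3}`: every finite subset is mapped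
injectively by some homomorphism `H →* ℤ/4 ⋉ ℤ/2^{n-1}` with `n ≥ 3`. -/
theorem Hgrp_fully_residually_semidirect (l k : ℕ) (hk : 2 ≤ k)
    (E : Set (Hgrp l k)) (hE : E.Finite) :
    ∃ n : ℕ, 3 ≤ n ∧
      ∃ α : Hgrp l k →* Zfour_sd (ZMod (2^(n-1))), Set.InjOn α E := by
  obtain ⟨s, hs, f, hf⟩ := exists_addMonoidHom_zmod_two_pow (l := l) k
    (hE.image2 (fun x y => x.left.toAdd - y.left.toAdd) hE)
  exact ⟨k + s + 1, by omega, Zfour_sd.map f, Zfour_sd.map_injOn f E fun x hx y hy =>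
    hf _ (Set.mem_image2_of_mem hx hy)⟩
end

section
/- Let l ≥ 0 and k ≥ 2 be integers, let H = ℤ/4ℤ ⋉ (ℤ^l ⊕ ℤ/2^k ℤ), let K = ⟨(2, 2^{k-1})⟩, and let G = H/K. Then G is fully residually quaternion: for every finite subset E ⊆ G there exist an integer n ≥ 3 and a group homomorphism α : G → Q_{2^n} whose restriction to E is injective. -/
theorem exists_addMonoidHom_int_ne_zero_s13 {l : ℕ} (F : Finset (Fin l → ℤ)) :
    ∃ f : (Fin l → ℤ) →+ ℤ, ∀ v ∈ F, v ≠ 0 → f v ≠ 0 := by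
  classical
  have hP : (∏ v ∈ F.erase 0, Polynomial.ofFn l v) ≠ 0 := by
    refine Finset.prod_ne_zero_iff.mpr fun v hv h => (Finset.mem_erase.mp hv).1 ?_
    exact Polynomial.injective_ofFn l (h.trans (map_zero _).symm)
  obtain ⟨b, hb⟩ : ∃ b : ℤ, (∏ v ∈ F.erase 0, Polynomial.ofFn l v).eval b ≠ 0 := by
    by_contra! h
    exact hP (Polynomial.funext fun b => by simpa using h b)
  rw [Polynomial.eval_prod, Finset.prod_ne_zero_iff] at hb
  exact ⟨((Polynomial.leval b).comp (Polynomial.ofFn l)).toAddMonoidHom,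
    fun v hv h => hb v (Finset.mem_erase.mpr ⟨h, hv⟩)⟩

theorem exists_addMonoidHom_zmod_ne_zero {l k : ℕ} (hk : 2 ≤ k) (F : Finset (Agrp l k)) :
    ∃ n : ℕ, 1 ≤ n ∧ ∃ φ : Agrp l k →+ ZMod (2 * 2 ^ n),
      φ ((0 : Fin l → ℤ), (2 ^ (k - 1) : ZMod (2 ^ k))) = ((2 ^ n : ℕ) : ZMod (2 * 2 ^ n)) ∧
      ∀ a ∈ F, a ≠ 0 → φ a ≠ 0 := by
  classical
  obtain ⟨f, hf⟩ := exists_addMonoidHom_int_ne_zero_s13 (F.image Prod.fst)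
  set m := ∑ a ∈ F, (f a.1).natAbs
  have hlt : ∀ a ∈ F, (f a.1).natAbs < 2 ^ m := fun a ha =>
    (Finset.single_le_sum (f := fun a : Agrp l k => (f a.1).natAbs)
      (fun _ _ => Nat.zero_le _) ha).trans_lt Nat.lt_two_pow_self
  have hmod : 2 * 2 ^ (m + (k - 1)) = 2 ^ m * 2 ^ k := by
    rw [← pow_succ', ← pow_add]; congr 1; omega
  set M := 2 * 2 ^ (m + (k - 1))
  let g : ZMod (2 ^ k) →+ ZMod M := ZMod.lift (2 ^ k)
    ⟨(AddMonoidHom.mulLeft ((2 ^ m : ℕ) : ZMod M)).comp (Int.castAddHom (ZMod M)), by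
      have h : ((2 ^ m * 2 ^ k : ℕ) : ZMod M) = 0 :=
        (congrArg Nat.cast hmod.symm).trans (ZMod.natCast_self M)
      simpa using h⟩
  have hg : ∀ x : ℤ, g (x : ZMod (2 ^ k)) = ((2 ^ m * x : ℤ) : ZMod M) := fun x => by
    simp [g]
  refine ⟨m + (k - 1), by omega,
    ((Int.castAddHom (ZMod M)).comp f).coprod g, ?_, ?_⟩
  · have h := hg (2 ^ (k - 1))
    push_cast at h
    simp [h, pow_add]
  · rintro ⟨v, c⟩ ha hne h
    obtain ⟨x, rfl⟩ := ZMod.intCast_surjective c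
    have h' : ((f v + 2 ^ m * x : ℤ) : ZMod M) = 0 := by
      have := hg x
      simp only [AddMonoidHom.coprod_apply, AddMonoidHom.comp_apply, Int.coe_castAddHom, this] at h
      exact_mod_cast h
    rw [ZMod.intCast_zmod_eq_zero_iff_dvd, hmod] at h'
    push_cast at h'
    have hv : v = 0 := by
      by_contra hv
      refine hf v (Finset.mem_image_of_mem Prod.fst ha) hv ?_
      refine Int.eq_zero_of_abs_lt_dvd (m := 2 ^ m) ?_ ?_
      · exact (dvd_add_left (dvd_mul_right _ _)).mp ((dvd_mul_right _ _).trans h')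
      · rw [Int.abs_eq_natAbs]; exact_mod_cast hlt _ ha
    subst hv
    refine hne (Prod.ext rfl ?_)
    rw [map_zero, zero_add] at h'
    refine (ZMod.intCast_zmod_eq_zero_iff_dvd x (2 ^ k)).mpr ?_
    push_cast
    exact (mul_dvd_mul_iff_left (by positivity)).mp h'

/-- The homomorphism `ℤ/4 → QuaternionGroup n` sending `1` to `xa 0`. -/
def zmodFourToQuaternion (n : ℕ) : Multiplicative (ZMod 4) →* QuaternionGroup n where
  toFun y := QuaternionGroup.xa 0 ^ (Multiplicative.toAdd y).val
  map_one' := by simp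
  map_mul' x y := by
    rw [toAdd_mul, ZMod.val_add, ← pow_add, ← pow_eq_pow_mod _ (QuaternionGroup.xa_pow_four 0)]

/-- The homomorphism `A → QuaternionGroup n` into the cyclic part induced by
`φ : A → ℤ/2n`. -/
def cyclicToQuaternion {A : Type*} [AddCommGroup A] {n : ℕ} (φ : A →+ ZMod (2 * n)) :
    Multiplicative A →* QuaternionGroup n where
  toFun a := QuaternionGroup.a (φ (Multiplicative.toAdd a))
  map_one' := by simp
  map_mul' x y := by simp

theorem cyclicToQuaternion_ofAdd {A : Type*} [AddCommGroup A] {n : ℕ} (φ : A →+ ZMod (2 * n))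
    (a : A) : cyclicToQuaternion φ (Multiplicative.ofAdd a) = QuaternionGroup.a (φ a) :=
  rfl

theorem natCast_add_self_zmod (n : ℕ) : (n : ZMod (2 * n)) + n = 0 := by
  rw [← two_mul]
  exact_mod_cast ZMod.natCast_self (2 * n)

theorem zmodFourToQuaternion_one (n : ℕ) :
    zmodFourToQuaternion n (Multiplicative.ofAdd 1) = QuaternionGroup.xa 0 :=
  pow_one _

theorem zmodFourToQuaternion_two (n : ℕ) :
    zmodFourToQuaternion n (Multiplicative.ofAdd 2) = QuaternionGroup.a n :=
  QuaternionGroup.xa_sq 0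

theorem zmodFourToQuaternion_three (n : ℕ) :
    zmodFourToQuaternion n (Multiplicative.ofAdd 3) = QuaternionGroup.xa n :=
  (pow_succ _ 2).trans <| by
    rw [QuaternionGroup.xa_sq, QuaternionGroup.a_mul_xa, zero_sub,
      neg_eq_of_add_eq_zero_left (natCast_add_self_zmod n)]

theorem ZMod.four_cases (x : ZMod 4) : x = 0 ∨ x = 1 ∨ x = 2 ∨ x = 3 := by
  decide +revert

/-- The homomorphism `ℤ/4 ⋉ A → QuaternionGroup n` induced by `φ : A → ℤ/2n`, sending the
generator of `ℤ/4` to `xa 0`. -/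
def sdToQuaternion {A : Type*} [AddCommGroup A] {n : ℕ} (φ : A →+ ZMod (2 * n)) :
    Zfour_sd A →* QuaternionGroup n :=
  SemidirectProduct.lift (cyclicToQuaternion φ) (zmodFourToQuaternion n) fun g =>
    MonoidHom.ext fun a => by
    obtain ⟨y, rfl⟩ := Multiplicative.ofAdd.surjective g
    obtain ⟨a, rfl⟩ := Multiplicative.ofAdd.surjective a
    change cyclicToQuaternion φ (negAct A (Multiplicative.ofAdd y) (Multiplicative.ofAdd a)) =
      _ * cyclicToQuaternion φ (Multiplicative.ofAdd a) * _
    rw [eq_mul_inv_iff_mul_eq]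
    obtain rfl | rfl | rfl | rfl := ZMod.four_cases y
    · rw [negAct_even _ (Or.inl rfl), ofAdd_zero, map_one, mul_one, one_mul, MulAut.one_apply]
    · rw [negAct_odd _ (Or.inl rfl), zmodFourToQuaternion_one, ← ofAdd_neg,
        cyclicToQuaternion_ofAdd, cyclicToQuaternion_ofAdd, map_neg, QuaternionGroup.a_mul_xa,
        QuaternionGroup.xa_mul_a, sub_neg_eq_add]
    · rw [negAct_even _ (Or.inr rfl), zmodFourToQuaternion_two]
      simp [cyclicToQuaternion_ofAdd, add_comm]
    · rw [negAct_odd _ (Or.inr rfl), zmodFourToQuaternion_three, ← ofAdd_neg,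
        cyclicToQuaternion_ofAdd, cyclicToQuaternion_ofAdd, map_neg, QuaternionGroup.a_mul_xa,
        QuaternionGroup.xa_mul_a, sub_neg_eq_add]

theorem sdToQuaternion_apply {A : Type*} [AddCommGroup A] {n : ℕ} (φ : A →+ ZMod (2 * n))
    (a : A) (y : Multiplicative (ZMod 4)) :
    sdToQuaternion φ ⟨Multiplicative.ofAdd a, y⟩ =
      QuaternionGroup.a (φ a) * zmodFourToQuaternion n y :=
  rfl

theorem eq_zero_or_two_of_sdToQuaternion_eq_one {A : Type*} [AddCommGroup A] {n : ℕ}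
    (φ : A →+ ZMod (2 * n)) (a : A) (y : ZMod 4)
    (h : sdToQuaternion φ ⟨Multiplicative.ofAdd a, Multiplicative.ofAdd y⟩ = 1) :
    (y = 0 ∧ φ a = 0) ∨ (y = 2 ∧ φ a + n = 0) := by
  rw [sdToQuaternion_apply, QuaternionGroup.one_def] at h
  obtain rfl | rfl | rfl | rfl := ZMod.four_cases y
  · rw [ofAdd_zero, map_one, mul_one] at h
    exact Or.inl ⟨rfl, QuaternionGroup.a.inj h⟩
  · rw [zmodFourToQuaternion_one] at h
    cases h
  · rw [zmodFourToQuaternion_two] at h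
    exact Or.inr ⟨rfl, QuaternionGroup.a.inj h⟩
  · rw [zmodFourToQuaternion_three] at h
    cases h

theorem sdToQuaternion_relHK {l k n : ℕ} (φ : Agrp l k →+ ZMod (2 * n))
    (h : φ ((0 : Fin l → ℤ), (2 ^ (k - 1) : ZMod (2 ^ k))) = n) :
    sdToQuaternion φ (relHK l k) = 1 := by
  rw [relHK, sdToQuaternion_apply, h, zmodFourToQuaternion_two, QuaternionGroup.a_mul_a,
    QuaternionGroup.one_def, natCast_add_self_zmod]

/-- For `l ≥ 0`, `k ≥ 2`, the group
`G = (ℤ/4 ⋉ (ℤ^l ⊕ ℤ/2^k)) / ⟨(2, 2^{k-1})⟩` is fully residually quaternion: every finite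
subset is mapped injectively by some homomorphism to a generalized quaternion group
`Q_{2^n}` (i.e. `QuaternionGroup (2^(n-2))`) with `n ≥ 3`. -/
theorem quotient_fully_residually_quaternion (l k : ℕ) (hk : 2 ≤ k)
    (E : Set (Hgrp l k ⧸ Subgroup.zpowers (relHK l k))) (hE : E.Finite) :
    ∃ n : ℕ, 3 ≤ n ∧
      ∃ α : (Hgrp l k ⧸ Subgroup.zpowers (relHK l k)) →* QuaternionGroup (2^(n-2)),
        Set.InjOn α E := by
  classical
  set K := Subgroup.zpowers (relHK l k)
  let a₀ : Agrp l k := ((0 : Fin l → ℤ), (2 ^ (k - 1) : ZMod (2 ^ k)))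
  let D : Finset (Hgrp l k ⧸ K) := (hE.toFinset ×ˢ hE.toFinset).image fun p => p.1⁻¹ * p.2
  let c : Hgrp l k ⧸ K → Agrp l k := fun d => Multiplicative.toAdd d.out.left
  obtain ⟨n, hn, φ, hφ, hF⟩ :=
    exists_addMonoidHom_zmod_ne_zero hk (D.image c ∪ D.image fun d => c d + a₀)
  let α : Hgrp l k ⧸ K →* QuaternionGroup (2 ^ n) :=
    QuotientGroup.lift K (sdToQuaternion φ)
      ((Subgroup.zpowers_le (H := (sdToQuaternion φ).ker)).mpr (sdToQuaternion_relHK φ hφ))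
  have hα : ∀ d ∈ D, α d = 1 → d = 1 := by
    intro d hd h
    have hc : c d ∈ D.image c ∪ D.image fun d => c d + a₀ :=
      Finset.mem_union_left _ (Finset.mem_image_of_mem c hd)
    have hc' : c d + a₀ ∈ D.image c ∪ D.image fun d => c d + a₀ :=
      Finset.mem_union_right _ (Finset.mem_image_of_mem (fun d => c d + a₀) hd)
    rw [← QuotientGroup.out_eq' d] at h ⊢
    rw [QuotientGroup.eq_one_iff]
    rcases eq_zero_or_two_of_sdToQuaternion_eq_one φ (c d) (Multiplicative.toAdd d.out.right) h with
      ⟨hy, ha⟩ | ⟨hy, ha⟩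
    · have h0 : c d = 0 := by_contra fun hne => hF _ hc hne ha
      have : d.out = 1 := SemidirectProduct.ext h0 hy
      rw [this]
      exact one_mem K
    · have h0 : c d + a₀ = 0 := by_contra fun hne => hF _ hc' hne (by rw [map_add, hφ, ha])
      have : d.out = relHK l k :=
        SemidirectProduct.ext ((eq_neg_of_add_eq_zero_left h0).trans
          (neg_eq_of_add_eq_zero_left (doublingA l k))) hy
      rw [this]
      exact Subgroup.mem_zpowers _
  refine ⟨n + 2, by omega, α, fun x hx y hy hxy => ?_⟩
  refine inv_mul_eq_one.mp (hα _ (Finset.mem_image.mpr ⟨(x, y), ?_, rfl⟩) ?_)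
  · simp [hx, hy]
  · rw [map_mul, map_inv, hxy, inv_mul_cancel]
end

section
/- Let l ≥ 0 and k ≥ 2 be integers, let H = ℤ/4ℤ ⋉ (ℤ^l ⊕ ℤ/2^k ℤ), let K = ⟨(2, 2^{k-1})⟩, and let G = H/K. Then G embeds in an ultraproduct of generalized quaternion groups: there exist a nonprincipal ultrafilter 𝒰 on {n ∈ ℕ : n ≥ 3} and an injective group homomorphism from G into (∏_{n ≥ 3} Q_{2^n})/N_𝒰, where N_𝒰 = {f ∈ ∏_{n ≥ 3} Q_{2^n} : {n : f(n) = 1} ∈ 𝒰} is the normal subgroup of elements trivial 𝒰-almost everywhere. -/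
section Ultraproduct

variable {I : Type*} (Q : I → Type*) [∀ i, Group (Q i)]

/-- The normal subgroup of `∏ i, Q i` of families that are trivial `𝒰`-almost
everywhere; the quotient by it is the ultraproduct `∏ Q i / 𝒰`. -/
def NU (𝒰 : Ultrafilter I) : Subgroup (∀ i, Q i) where
  carrier := {f | {i | f i = 1} ∈ 𝒰}
  one_mem' := by
    simp only [Set.mem_setOf_eq, Pi.one_apply, Set.setOf_true]
    exact Filter.univ_mem
  mul_mem' := by
    intro f g hf hg
    have hsub : {i | f i = 1} ∩ {i | g i = 1} ⊆ {i | (f * g) i = 1} := by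
      rintro i ⟨h1, h2⟩
      simp only [Set.mem_setOf_eq] at *
      simp [h1, h2]
    exact Filter.mem_of_superset (Filter.inter_mem hf hg) hsub
  inv_mem' := by
    intro f hf
    have hsub : {i | f i = 1} ⊆ {i | f⁻¹ i = 1} := by
      intro i h
      simp only [Set.mem_setOf_eq] at *
      simp [h]
    exact Filter.mem_of_superset hf hsub

instance NU_normal (𝒰 : Ultrafilter I) : (NU Q 𝒰).Normal := by
  constructor
  intro f hf g
  have hsub : {i | f i = 1} ⊆ {i | (g * f * g⁻¹) i = 1} := by
    intro i h
    simp only [Set.mem_setOf_eq] at *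
    simp [h]
  exact Filter.mem_of_superset hf hsub

end Ultraproduct

namespace QuaternionGroup

variable {A : Type*} [AddCommGroup A] {m : ℕ}

theorem a_eq_one_iff {i : ZMod (2 * m)} : a i = 1 ↔ i = 0 := by
  rw [one_def, a.injEq]

theorem inv_a (i : ZMod (2 * m)) : (a i)⁻¹ = a (-i) :=
  rfl

theorem xa_ne_one (i : ZMod (2 * m)) : xa i ≠ 1 := by
  rw [one_def]
  exact nofun

/-- An additive map `A → ℤ/2m` as a homomorphism into the cyclic subgroup of rotations. -/
def rotationHom (θ : A →+ ZMod (2 * m)) : Multiplicative A →* QuaternionGroup m where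
  toFun x := a (θ x.toAdd)
  map_one' := by simp
  map_mul' x y := by simp

theorem rotationHom_ofAdd (θ : A →+ ZMod (2 * m)) (x : A) :
    rotationHom θ (Multiplicative.ofAdd x) = a (θ x) :=
  rfl

/-- The homomorphism `ℤ/4 → QuaternionGroup m` sending `1` to `xa 0`. -/
def xaHom (m : ℕ) : Multiplicative (ZMod 4) →* QuaternionGroup m where
  toFun z := xa 0 ^ z.toAdd.val
  map_one' := by simp
  map_mul' x y := by
    rw [toAdd_mul, ZMod.val_add, ← pow_eq_pow_mod _ (xa_pow_four 0), pow_add]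

/-- The homomorphism `ℤ/4 ⋉ A → QuaternionGroup m` extending an additive map `A → ℤ/2m`
and sending the generator of `ℤ/4` to `xa 0`. -/
def ofZfourSd (θ : A →+ ZMod (2 * m)) : Zfour_sd A →* QuaternionGroup m :=
  SemidirectProduct.lift (rotationHom θ) (xaHom m) (by
    intro g
    ext x
    obtain ⟨z, rfl⟩ := Multiplicative.ofAdd.surjective g
    have hm : (m : ZMod (2 * m)) + m = 0 := by
      rw [← two_mul]; exact_mod_cast ZMod.natCast_self (2 * m)
    have hneg : -(m : ZMod (2 * m)) = m := neg_eq_of_add_eq_zero_left hm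
    have hneg1 : negAct A (Multiplicative.ofAdd 1) (Multiplicative.ofAdd x) =
        Multiplicative.ofAdd (-x) := rfl
    have hneg3 : negAct A (Multiplicative.ofAdd 3) (Multiplicative.ofAdd x) =
        Multiplicative.ofAdd (-x) := rfl
    have hv1 : (1 : ZMod 4).val = 1 := rfl
    have hv2 : (2 : ZMod 4).val = 2 := rfl
    have hv3 : (3 : ZMod 4).val = 3 := rfl
    have hz : z = 0 ∨ z = 1 ∨ z = 2 ∨ z = 3 := by revert z; decide
    rcases hz with rfl | rfl | rfl | rfl
    · simp
    · simp [hneg1, rotationHom_ofAdd, xaHom, hv1, eq_mul_inv_iff_mul_eq, inv_a]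
    · rw [negAct_even _ (Or.inr rfl)]
      simp [rotationHom_ofAdd, xaHom, hv2, eq_mul_inv_iff_mul_eq, add_comm]
    · simp [hneg3, rotationHom_ofAdd, xaHom, hv3, eq_mul_inv_iff_mul_eq, pow_succ,
        sub_eq_add_neg, hneg, inv_a])

theorem ofZfourSd_mk (θ : A →+ ZMod (2 * m)) (x : A) (z : ZMod 4) :
    ofZfourSd θ ⟨Multiplicative.ofAdd x, Multiplicative.ofAdd z⟩ = a (θ x) * xa 0 ^ z.val :=
  rfl

theorem ofZfourSd_mk_zero_eq_one (θ : A →+ ZMod (2 * m)) (x : A) :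
    ofZfourSd θ ⟨Multiplicative.ofAdd x, Multiplicative.ofAdd 0⟩ = 1 ↔ θ x = 0 := by
  rw [ofZfourSd_mk, ZMod.val_zero, pow_zero, mul_one, a_eq_one_iff]

theorem ofZfourSd_mk_two_eq_one (θ : A →+ ZMod (2 * m)) (x : A) (hx : θ x = m) :
    ofZfourSd θ ⟨Multiplicative.ofAdd x, Multiplicative.ofAdd 2⟩ = 1 := by
  have hm : (m : ZMod (2 * m)) + m = 0 := by
    rw [← two_mul]; exact_mod_cast ZMod.natCast_self (2 * m)
  rw [ofZfourSd_mk, show (2 : ZMod 4).val = 2 from rfl, hx, xa_sq, a_mul_a, hm, a_zero]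

theorem eq_zero_or_two_of_ofZfourSd_eq_one (θ : A →+ ZMod (2 * m)) {x : A} {z : ZMod 4}
    (h : ofZfourSd θ ⟨Multiplicative.ofAdd x, Multiplicative.ofAdd z⟩ = 1) :
    z = 0 ∨ z = 2 := by
  have hz : z = 0 ∨ z = 1 ∨ z = 2 ∨ z = 3 := by clear h; revert z; decide
  rw [ofZfourSd_mk] at h
  rcases hz with rfl | rfl | rfl | rfl
  · exact Or.inl rfl
  · simp [show (1 : ZMod 4).val = 1 from rfl, xa_ne_one] at h
  · exact Or.inr rfl
  · simp [show (3 : ZMod 4).val = 3 from rfl, pow_succ, xa_ne_one] at h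

end QuaternionGroup

open Filter Asymptotics Topology in
theorem eventually_abs_sum_mul_pow_lt {l : ℕ} (v : Fin l → ℤ) (k : ℕ) :
    ∀ᶠ n : ℕ in atTop, |∑ j, v j * (n : ℤ) ^ (j : ℕ)| < 2 ^ (n - 1 - k) := by
  have ho : (fun n : ℕ => ∑ j, (v j : ℝ) * (n : ℝ) ^ (j : ℕ)) =o[atTop]
      fun n : ℕ => (2 : ℝ) ^ n :=
    IsLittleO.fun_sum fun j _ =>
      (isLittleO_pow_const_const_pow_of_one_lt (j : ℕ) one_lt_two).const_mul_left _
  filter_upwards [ho.def (c := 1 / 2 ^ (k + 2)) (by positivity), eventually_ge_atTop (k + 2)]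
    with n hn hkn
  obtain ⟨d, rfl⟩ := Nat.exists_eq_add_of_le hkn
  have hlt : |∑ j, (v j : ℝ) * ((k + 2 + d : ℕ) : ℝ) ^ (j : ℕ)| < 2 ^ (d + 1) := by
    have hd : (0 : ℝ) < 2 ^ d := by positivity
    calc _ ≤ _ := hn
      _ = 2 ^ d := by
        rw [Real.norm_of_nonneg (by positivity), pow_add 2 (k + 2) d, ← mul_assoc,
          one_div_mul_cancel (by positivity), one_mul]
      _ < _ := by rw [pow_succ]; linarith
  rw [show k + 2 + d - 1 - k = d + 1 by omega]
  exact_mod_cast hlt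

open Filter Polynomial in
theorem eventually_sum_mul_pow_ne_zero {l : ℕ} {v : Fin l → ℤ} (hv : v ≠ 0) :
    ∀ᶠ n : ℕ in atTop, ∑ j, v j * (n : ℤ) ^ (j : ℕ) ≠ 0 := by
  set p : ℤ[X] := ∑ j, C (v j) * X ^ (j : ℕ) with hp
  have hcoeff (i : Fin l) : p.coeff i = v i := by
    simp [hp, coeff_X_pow, Fin.val_inj]
  have hp0 : p ≠ 0 := by
    rintro h
    exact hv (funext fun i => by rw [← hcoeff i, h]; simp)
  have hfin : {n : ℕ | p.IsRoot (n : ℤ)}.Finite :=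
    (finite_setOfPred_isRoot hp0).preimage Nat.cast_injective.injOn
  rw [← Nat.cofinite_eq_atTop]
  filter_upwards [hfin.compl_mem_cofinite] with n hn h0
  apply hn
  simpa [hp, IsRoot.def, eval_finsetSum] using h0

/-- The map `ℤ/2^k → ℤ/2m` sending `1` to `2m/2^k`, when `2^k` divides `2m`. -/
def torsionHom (k m d : ℕ) (h : 2 * m = 2 ^ k * d) : ZMod (2 ^ k) →+ ZMod (2 * m) :=
  ZMod.lift (2 ^ k) ⟨(AddMonoidHom.mulRight (d : ZMod (2 * m))).comp (Int.castAddHom _), by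
    have hd : ((2 ^ k * d : ℕ) : ZMod (2 * m)) = 0 := by rw [← h, ZMod.natCast_self]
    simpa using hd⟩

theorem torsionHom_natCast {k m d : ℕ} (h : 2 * m = 2 ^ k * d) (t : ℕ) :
    torsionHom k m d h t = (t * d : ℕ) := by
  rw [← Int.cast_natCast t, torsionHom, ZMod.lift_coe]
  simp

/-- The map `ℤ^l ⊕ ℤ/2^k → ℤ/2m` sending `v` to `∑ j, v j * n ^ j` and extending
`torsionHom`. -/
def coordHom (l k n m d : ℕ) (h : 2 * m = 2 ^ k * d) : Agrp l k →+ ZMod (2 * m) :=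
  AddMonoidHom.coprod
    { toFun := fun v => ((∑ j, v j * (n : ℤ) ^ (j : ℕ) : ℤ) : ZMod (2 * m))
      map_zero' := by simp
      map_add' := fun v w => by simp [add_mul, Finset.sum_add_distrib] }
    (torsionHom k m d h)

theorem coordHom_apply {l k n m d : ℕ} (h : 2 * m = 2 ^ k * d) (v : Fin l → ℤ)
    (t : ZMod (2 ^ k)) :
    coordHom l k n m d h (v, t) =
      ((∑ j, v j * (n : ℤ) ^ (j : ℕ) + t.val * d : ℤ) : ZMod (2 * m)) := by
  have ht := torsionHom_natCast h t.val
  rw [ZMod.natCast_zmod_val] at ht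
  simp [coordHom, ht]

theorem coordHom_half {l k n m d : ℕ} (hk : 1 ≤ k) (h : 2 * m = 2 ^ k * d) :
    coordHom l k n m d h (0, 2 ^ (k - 1)) = m := by
  have ht := torsionHom_natCast h (2 ^ (k - 1))
  have hm : 2 ^ (k - 1) * d = m := by
    obtain ⟨k, rfl⟩ := Nat.exists_eq_add_of_le' hk
    rw [pow_succ'] at h
    rw [Nat.add_sub_cancel]
    linarith
  rw [hm] at ht
  push_cast at ht
  simp [coordHom, ht]

theorem coordHom_eq_zero {l k n m d : ℕ} (h : 2 * m = 2 ^ k * d) {v : Fin l → ℤ}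
    {t : ZMod (2 ^ k)} (hlt : |∑ j, v j * (n : ℤ) ^ (j : ℕ)| < d)
    (hne : v ≠ 0 → ∑ j, v j * (n : ℤ) ^ (j : ℕ) ≠ 0)
    (h0 : coordHom l k n m d h (v, t) = 0) : v = 0 ∧ t = 0 := by
  rw [coordHom_apply, ZMod.intCast_zmod_eq_zero_iff_dvd, h] at h0
  push_cast at h0
  have hdvd : (d : ℤ) ∣ ∑ j, v j * (n : ℤ) ^ (j : ℕ) :=
    (dvd_add_left (dvd_mul_left _ _)).1 ((dvd_mul_left _ _).trans h0)
  have hP := Int.eq_zero_of_abs_lt_dvd hdvd hlt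
  refine ⟨by_contra fun hv => hne hv hP, ?_⟩
  rw [hP, zero_add] at h0
  have hd : (d : ℤ) ≠ 0 := ((abs_nonneg _).trans_lt hlt).ne'
  have h1 : 2 ^ k ∣ t.val := by exact_mod_cast Int.dvd_of_mul_dvd_mul_right hd h0
  exact (ZMod.val_eq_zero t).1 (Nat.eq_zero_of_dvd_of_lt h1 (ZMod.val_lt t))

open Filter in
theorem exists_family_coordHom (l k : ℕ) (hk : 1 ≤ k) :
    ∃ θ : ∀ n : ℕ, Agrp l k →+ ZMod (2 * 2 ^ (n - 2)),
      (∀ᶠ n in atTop, θ n (0, 2 ^ (k - 1)) = (2 ^ (n - 2) : ℕ)) ∧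
      ∀ x, x ≠ 0 → ∀ᶠ n in atTop, θ n x ≠ 0 := by
  have key (n : ℕ) (hn : k + 2 ≤ n) : 2 * 2 ^ (n - 2) = 2 ^ k * 2 ^ (n - 1 - k) := by
    rw [← pow_succ', ← pow_add]
    congr 1
    omega
  refine ⟨fun n => if hn : k + 2 ≤ n then coordHom l k n _ _ (key n hn) else 0, ?_, ?_⟩
  · filter_upwards [eventually_ge_atTop (k + 2)] with n hn
    rw [dif_pos hn, coordHom_half hk]
  · rintro ⟨v, t⟩ hx
    have hne : ∀ᶠ n : ℕ in atTop, v ≠ 0 → ∑ j, v j * (n : ℤ) ^ (j : ℕ) ≠ 0 := by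
      by_cases hv : v = 0
      · simp [hv]
      · filter_upwards [eventually_sum_mul_pow_ne_zero hv] with n hn _ using hn
    filter_upwards [eventually_ge_atTop (k + 2), hne, eventually_abs_sum_mul_pow_lt v k]
      with n hn hne hlt h0
    rw [dif_pos hn] at h0
    obtain ⟨rfl, rfl⟩ := coordHom_eq_zero (key n hn) (by exact_mod_cast hlt) hne h0
    exact hx rfl

/-- For `l ≥ 0`, `k ≥ 2`, the group
`G = (ℤ/4 ⋉ (ℤ^l ⊕ ℤ/2^k)) / ⟨(2, 2^{k-1})⟩` embeds in an ultraproduct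
`(∏_{n ≥ 3} Q_{2^n}) / 𝒰` for some nonprincipal ultrafilter `𝒰` on `{n : ℕ // 3 ≤ n}`,
where `Q_{2^n} = QuaternionGroup (2^(n-2))`. -/
theorem quotient_embeds_in_ultraproduct (l k : ℕ) (hk : 2 ≤ k) :
    ∃ 𝒰 : Ultrafilter {n : ℕ // 3 ≤ n},
      (∀ i : {n : ℕ // 3 ≤ n}, 𝒰 ≠ pure i) ∧
      ∃ φ : (Hgrp l k ⧸ Subgroup.zpowers (relHK l k)) →*
          (∀ i : {n : ℕ // 3 ≤ n}, QuaternionGroup (2^(i.1 - 2))) ⧸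
            NU (fun i : {n : ℕ // 3 ≤ n} => QuaternionGroup (2^(i.1 - 2))) 𝒰,
        Function.Injective φ := by
  obtain ⟨θ, hhalf, hne⟩ := exists_family_coordHom l k (by omega)
  have : Infinite {n : ℕ // 3 ≤ n} := (Set.Ici_infinite 3).to_subtype
  have hlim : Filter.Tendsto (fun i : {n : ℕ // 3 ≤ n} => i.1)
      (Filter.hyperfilter {n : ℕ // 3 ≤ n}) Filter.atTop := by
    rw [← Nat.cofinite_eq_atTop]
    exact Subtype.val_injective.tendsto_cofinite.mono_left Filter.hyperfilter_le_cofinite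
  set 𝒰 := Filter.hyperfilter {n : ℕ // 3 ≤ n}
  refine ⟨𝒰, fun i hi => ?_, ?_⟩
  · refine Filter.notMem_hyperfilter_of_finite (Set.finite_singleton i) ?_
    change {i} ∈ 𝒰
    rw [hi]
    exact Ultrafilter.mem_pure.2 rfl
  let ψ := (QuotientGroup.mk' (NU (fun i : {n : ℕ // 3 ≤ n} => QuaternionGroup (2 ^ (i.1 - 2)))
    𝒰)).comp (MonoidHom.pi fun i => QuaternionGroup.ofZfourSd (θ i.1))
  have hmem (g : Hgrp l k) :
      ψ g = 1 ↔
      ∀ᶠ i : {n : ℕ // 3 ≤ n} in (𝒰 : Filter {n : ℕ // 3 ≤ n}),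
        QuaternionGroup.ofZfourSd (θ i.1) g = 1 :=
    QuotientGroup.eq_one_iff _
  have hrel := (hmem (relHK l k)).2 <| (hlim.eventually hhalf).mono fun i hi =>
    QuaternionGroup.ofZfourSd_mk_two_eq_one _ _ hi
  have hzero (x : Agrp l k)
      (hx : ψ ⟨Multiplicative.ofAdd x, Multiplicative.ofAdd 0⟩ = 1) : x = 0 := by
    by_contra hx0
    obtain ⟨i, hi, hi'⟩ := (((hmem _).1 hx).and (hlim.eventually (hne x hx0))).exists
    exact hi' ((QuaternionGroup.ofZfourSd_mk_zero_eq_one _ _).1 hi)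
  refine ⟨QuotientGroup.lift _ ψ ((Subgroup.zpowers_le (H := ψ.ker)).2 hrel), ?_⟩
  rw [injective_iff_map_eq_one]
  intro q hq
  obtain ⟨g, rfl⟩ := QuotientGroup.mk_surjective q
  rw [QuotientGroup.lift_mk] at hq
  rw [QuotientGroup.eq_one_iff]
  obtain ⟨x, z⟩ := g
  obtain ⟨x, rfl⟩ := Multiplicative.ofAdd.surjective x
  obtain ⟨z, rfl⟩ := Multiplicative.ofAdd.surjective z
  obtain ⟨i, hi⟩ := ((hmem _).1 hq).exists
  rcases QuaternionGroup.eq_zero_or_two_of_ofZfourSd_eq_one _ hi with rfl | rfl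
  · rw [hzero x hq]
    exact one_mem _
  · have hmul : relHK l k * ⟨Multiplicative.ofAdd x, Multiplicative.ofAdd 2⟩ =
        ⟨Multiplicative.ofAdd ((0, 2 ^ (k - 1)) + x), Multiplicative.ofAdd 0⟩ := by
      ext1
      · rw [SemidirectProduct.mul_left, relHK, negAct_even _ (Or.inr rfl)]
        rfl
      · rw [SemidirectProduct.mul_right, relHK]
        exact congrArg Multiplicative.ofAdd (show (2 + 2 : ZMod 4) = 0 from rfl)
    have h1 := hzero ((0, 2 ^ (k - 1)) + x) (by rw [← hmul, map_mul, hrel, hq, mul_one])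
    rw [h1] at hmul
    rw [eq_inv_of_mul_eq_one_right hmul]
    exact inv_mem (Subgroup.mem_zpowers _)
end
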